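/- arXiv:2207.05540 — 2 statements merged into one kernel-verified Lean document; each statement's English description precedes it below -/
import Mathlib

section
/- Let (C, Δ, δ) be a coalgebra over ℂ and let ψ be a linear functional on C. Then for every c ∈ C the series Σ_{k=0}^∞ ψ^{⋆k}(c)/k! converges in ℂ. (Its sum defines the convolution exponential exp_⋆ψ, a linear functional on C.) -/
/-!
The convolution exponential series Σ ψ^{⋆k}(c)/k! converges for every element c of a
coalgebra.
-/

open scoped TensorProduct

noncomputable section

/-- Convolution of linear functionals on a coalgebra: φ⋆ψ = (φ⊗ψ)∘Δ. -/
def conv {C : Type*} [AddCommGroup C] [Module ℂ C] [Coalgebra ℂ C]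
    (φ ψ : C →ₗ[ℂ] ℂ) : C →ₗ[ℂ] ℂ :=
  (TensorProduct.lid ℂ ℂ).toLinearMap ∘ₗ TensorProduct.map φ ψ ∘ₗ Coalgebra.comul (R := ℂ)

/-- Convolution powers ψ^{⋆k}, with ψ^{⋆0} = δ (the counit). -/
def convPow {C : Type*} [AddCommGroup C] [Module ℂ C] [Coalgebra ℂ C]
    (ψ : C →ₗ[ℂ] ℂ) : ℕ → (C →ₗ[ℂ] ℂ)
  | 0 => Coalgebra.counit (R := ℂ)
  | (k + 1) => conv (convPow ψ k) ψ

/-- Contraction of the right tensor factor of `x` with a linear functional. -/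
def contractRightFactor {C : Type*} [AddCommGroup C] [Module ℂ C] (x : C ⊗[ℂ] C) :
    (C →ₗ[ℂ] ℂ) →ₗ[ℂ] C where
  toFun φ := TensorProduct.rid ℂ C (φ.lTensor C x)
  map_add' φ χ := by simp [LinearMap.lTensor_add]
  map_smul' a φ := by simp [LinearMap.lTensor_smul]

theorem contractRightFactor_apply {C : Type*} [AddCommGroup C] [Module ℂ C] (x : C ⊗[ℂ] C)
    (φ : C →ₗ[ℂ] ℂ) : contractRightFactor x φ = TensorProduct.rid ℂ C (φ.lTensor C x) := rfl

theorem finiteDimensional_range_contractRightFactor {C : Type*} [AddCommGroup C] [Module ℂ C]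
    (x : C ⊗[ℂ] C) : FiniteDimensional ℂ (LinearMap.range (contractRightFactor x)) := by
  induction x with
  | zero =>
    refine Submodule.finiteDimensional_of_le (S₂ := ⊥) ?_
    rintro _ ⟨φ, rfl⟩
    simp [contractRightFactor_apply]
  | tmul a b =>
    refine Submodule.finiteDimensional_of_le (S₂ := ℂ ∙ a) ?_
    rintro _ ⟨φ, rfl⟩
    exact Submodule.mem_span_singleton.2 ⟨φ b, by simp [contractRightFactor_apply]⟩
  | add x y hx hy =>
    refine Submodule.finiteDimensional_of_le
      (S₂ := LinearMap.range (contractRightFactor x) ⊔ LinearMap.range (contractRightFactor y)) ?_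
    rintro _ ⟨φ, rfl⟩
    exact Submodule.mem_sup.2 ⟨_, ⟨φ, rfl⟩, _, ⟨φ, rfl⟩, by simp [contractRightFactor_apply]⟩

theorem conv_eq_ofConv_mul {C : Type*} [AddCommGroup C] [Module ℂ C] [Coalgebra ℂ C]
    (φ ψ : C →ₗ[ℂ] ℂ) :
    conv φ ψ = (WithConv.toConv φ * WithConv.toConv ψ).ofConv := by
  have h : (TensorProduct.lid ℂ ℂ).toLinearMap = LinearMap.mul' ℂ ℂ := by ext; simp
  simp [conv, LinearMap.convMul_def, h]

theorem conv_assoc {C : Type*} [AddCommGroup C] [Module ℂ C] [Coalgebra ℂ C]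
    (φ χ ψ : C →ₗ[ℂ] ℂ) : conv (conv φ χ) ψ = conv φ (conv χ ψ) := by
  simp [conv_eq_ofConv_mul, mul_assoc]

/-- The linear endomorphism `c ↦ c₍₁₎ ψ(c₍₂₎)` of a coalgebra. -/
def convRight {C : Type*} [AddCommGroup C] [Module ℂ C] [Coalgebra ℂ C]
    (ψ : C →ₗ[ℂ] ℂ) : C →ₗ[ℂ] C :=
  (TensorProduct.rid ℂ C).toLinearMap ∘ₗ ψ.lTensor C ∘ₗ Coalgebra.comul (R := ℂ)

theorem convRight_apply {C : Type*} [AddCommGroup C] [Module ℂ C] [Coalgebra ℂ C]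
    (ψ : C →ₗ[ℂ] ℂ) (c : C) :
    convRight ψ c = contractRightFactor (Coalgebra.comul (R := ℂ) c) ψ := rfl

theorem comp_convRight {C : Type*} [AddCommGroup C] [Module ℂ C] [Coalgebra ℂ C]
    (φ ψ : C →ₗ[ℂ] ℂ) : φ ∘ₗ convRight ψ = conv φ ψ := by
  have h : φ ∘ₗ (TensorProduct.rid ℂ C).toLinearMap ∘ₗ ψ.lTensor C =
      (TensorProduct.lid ℂ ℂ).toLinearMap ∘ₗ TensorProduct.map φ ψ := by
    ext a b
    simp [mul_comm]
  exact congrArg (· ∘ₗ Coalgebra.comul (R := ℂ)) h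

theorem convRight_comp_convRight {C : Type*} [AddCommGroup C] [Module ℂ C] [Coalgebra ℂ C]
    (φ ψ : C →ₗ[ℂ] ℂ) : convRight ψ ∘ₗ convRight φ = convRight (conv ψ φ) := by
  ext c
  refine Module.eval_apply_injective ℂ (LinearMap.ext fun χ => ?_)
  change ((χ ∘ₗ convRight ψ) ∘ₗ convRight φ) c = (χ ∘ₗ convRight (conv ψ φ)) c
  simp only [comp_convRight, conv_assoc]

theorem convRight_counit {C : Type*} [AddCommGroup C] [Module ℂ C] [Coalgebra ℂ C] (c : C) :
    convRight (Coalgebra.counit (R := ℂ)) c = c := by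
  simp [convRight]

theorem convPow_eq_counit_comp {C : Type*} [AddCommGroup C] [Module ℂ C] [Coalgebra ℂ C]
    (ψ : C →ₗ[ℂ] ℂ) (k : ℕ) :
    convPow ψ k = Coalgebra.counit (R := ℂ) ∘ₗ (convRight ψ ^ k) := by
  induction k with
  | zero => rfl
  | succ k ih =>
    rw [convPow, ← comp_convRight, ih, pow_succ]
    rfl

/-- The exponential series of an endomorphism of a finite-dimensional space converges
under every linear functional on the endomorphism algebra. -/
theorem summable_exp_apply_of_finiteDimensional {W : Type*} [AddCommGroup W] [Module ℂ W]
    [FiniteDimensional ℂ W] (f : Module.End ℂ W) (l : Module.End ℂ W →ₗ[ℂ] ℂ) :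
    Summable fun k : ℕ => ((k.factorial : ℂ))⁻¹ * l (f ^ k) := by
  classical
  let : NormedRing (Matrix (Fin (Module.finrank ℂ W)) (Fin (Module.finrank ℂ W)) ℂ) :=
    Matrix.linftyOpNormedRing
  let : NormedAlgebra ℂ (Matrix (Fin (Module.finrank ℂ W)) (Fin (Module.finrank ℂ W)) ℂ) :=
    Matrix.linftyOpNormedAlgebra
  let e := LinearMap.toMatrixAlgEquiv (Module.finBasis ℂ W)
  let m := l ∘ₗ e.symm.toLinearMap
  have hs := (NormedSpace.expSeries_summable' (𝕂 := ℂ) (e f)).map m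
    (LinearMap.continuous_of_finiteDimensional m)
  refine hs.congr fun k => ?_
  simp [m, ← map_pow]

/-- For every linear functional ψ on a coalgebra C and every c ∈ C, the series
Σ_{k=0}^∞ ψ^{⋆k}(c)/k! converges in ℂ (its sum defines the convolution exponential
exp_⋆ψ). -/
theorem convolution_exponential_series_converges
    {C : Type*} [AddCommGroup C] [Module ℂ C] [Coalgebra ℂ C] (ψ : C →ₗ[ℂ] ℂ)
    (c : C) :
    ∃ s : ℂ, Filter.Tendsto
      (fun N : ℕ => ∑ k ∈ Finset.range N, ((k.factorial : ℂ))⁻¹ * convPow ψ k c)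
      Filter.atTop (nhds s) := by
  let W := LinearMap.range (contractRightFactor (Coalgebra.comul (R := ℂ) c))
  have hW : FiniteDimensional ℂ W := finiteDimensional_range_contractRightFactor _
  have hinv : ∀ w ∈ W, convRight ψ w ∈ W := by
    rintro _ ⟨φ, rfl⟩
    exact ⟨conv ψ φ, (LinearMap.congr_fun (convRight_comp_convRight φ ψ) c).symm⟩
  let w : W := ⟨c, Coalgebra.counit (R := ℂ), convRight_counit c⟩
  let l : Module.End ℂ W →ₗ[ℂ] ℂ :=
    Coalgebra.counit (R := ℂ) ∘ₗ W.subtype ∘ₗ LinearMap.applyₗ w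
  have hs := summable_exp_apply_of_finiteDimensional ((convRight ψ).restrict hinv) l
  refine ⟨_, (hs.congr fun k => ?_).hasSum.tendsto_sum_nat⟩
  rw [convPow_eq_counit_comp, Module.End.pow_restrict]
  rfl

end
end

section
/- Let (C, Δ, δ) be a coalgebra over ℂ and let ψ be a linear functional on C. Then for every c ∈ C, the sequence (δ + ψ/n)^{⋆n}(c) converges, as n → ∞, to (exp_⋆ψ)(c) = Σ_{k=0}^∞ ψ^{⋆k}(c)/k!. -/
/-!
Euler formula for the convolution exponential: (δ + ψ/n)^{⋆n}(c) → (exp_⋆ψ)(c).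
-/

open scoped TensorProduct

noncomputable section

open Filter Polynomial

/-- A sequence satisfying a linear recurrence with constant coefficients grows at most
geometrically. -/
lemma exists_norm_le_geometric_of_recurrence {𝕜 : Type*} [NormedField 𝕜] {a b : ℕ → 𝕜} {m : ℕ}
    (h : ∀ k, a (k + m) = ∑ j ∈ Finset.range m, b j * a (k + j)) :
    ∃ M R : ℝ, ∀ k, ‖a k‖ ≤ M * R ^ k := by
  set B := ∑ j ∈ Finset.range m, ‖b j‖ with hB
  set M := ∑ j ∈ Finset.range m, ‖a j‖ with hM
  have hB0 : 0 ≤ B := by positivity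
  have hM0 : 0 ≤ M := by positivity
  refine ⟨M, 1 + B, fun k ↦ ?_⟩
  induction k using Nat.strong_induction_on with
  | _ k ih =>
    rcases lt_or_ge k m with hk | hk
    · calc ‖a k‖ ≤ M :=
            Finset.single_le_sum (f := fun j ↦ ‖a j‖) (fun _ _ ↦ norm_nonneg _)
              (Finset.mem_range.2 hk)
        _ ≤ M * (1 + B) ^ k := le_mul_of_one_le_right hM0 (one_le_pow₀ (by linarith))
    · obtain ⟨l, rfl⟩ := Nat.exists_eq_add_of_le' hk
      rcases Nat.eq_zero_or_pos m with rfl | hm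
      · rw [h l]
        simpa using mul_nonneg hM0 (pow_nonneg (by linarith) l)
      have hstep : ∀ j ∈ Finset.range m,
          ‖b j * a (l + j)‖ ≤ ‖b j‖ * (M * (1 + B) ^ (l + m - 1)) := fun j hj ↦ by
        have hj := Finset.mem_range.1 hj
        rw [norm_mul]
        gcongr
        refine (ih (l + j) (by lia)).trans ?_
        gcongr
        · linarith
        · lia
      calc ‖a (l + m)‖ ≤ ∑ j ∈ Finset.range m, ‖b j‖ * (M * (1 + B) ^ (l + m - 1)) := by
            rw [h l]
            exact norm_sum_le_of_le _ hstep
        _ = M * (1 + B) ^ (l + m - 1) * B := by rw [← Finset.sum_mul, mul_comm]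
        _ ≤ M * (1 + B) ^ (l + m - 1) * (1 + B) := by gcongr; linarith
        _ = M * (1 + B) ^ (l + m) := by
            rw [mul_assoc, ← pow_succ, Nat.sub_add_cancel (by lia)]

/-- The coefficients of `(1 + x / n) ^ n` converge to those of the exponential series. -/
lemma tendsto_choose_mul_inv_pow (k : ℕ) :
    Tendsto (fun n : ℕ ↦ (n.choose k : ℂ) * ((n : ℂ)⁻¹) ^ k) atTop
      (nhds ((k.factorial : ℂ)⁻¹)) := by
  have h : Tendsto (fun n : ℕ ↦ (n.choose k : ℝ) * ((n : ℝ)⁻¹) ^ k) atTop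
      (nhds ((k.factorial : ℝ)⁻¹)) := by
    have h1 : Tendsto (fun n : ℕ ↦ (n : ℝ) * (n : ℝ)⁻¹) atTop (nhds 1) :=
      tendsto_const_nhds.congr' <| by
        filter_upwards [eventually_ne_atTop 0] with n hn
        rw [mul_inv_cancel₀ (by exact_mod_cast hn)]
    simpa using ProbabilityTheory.tendsto_choose_mul_pow_atTop k h1
  simpa [Function.comp_def] using (Complex.continuous_ofReal.tendsto _).comp h

lemma norm_choose_mul_inv_pow_le (n k : ℕ) :
    ‖(n.choose k : ℂ) * ((n : ℂ)⁻¹) ^ k‖ ≤ (k.factorial : ℝ)⁻¹ := by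
  rw [norm_mul, norm_pow, norm_inv, Complex.norm_natCast, Complex.norm_natCast, inv_pow]
  refine mul_inv_le_of_le_mul₀ (by positivity) (by positivity) ?_
  rw [mul_comm, ← div_eq_mul_inv]
  exact Nat.choose_le_pow_div k n

/-- Euler's limit formula for a sequence of geometric growth in place of the powers of a number. -/
lemma tendsto_sum_choose_mul_inv_pow_mul {a : ℕ → ℂ} {M R : ℝ} (ha : ∀ k, ‖a k‖ ≤ M * R ^ k) :
    ∃ s : ℂ,
      Tendsto (fun N : ℕ ↦ ∑ k ∈ Finset.range N, (k.factorial : ℂ)⁻¹ * a k) atTop (nhds s) ∧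
      Tendsto (fun n : ℕ ↦ ∑ k ∈ Finset.range (n + 1),
        (n.choose k : ℂ) * ((n : ℂ)⁻¹) ^ k * a k) atTop (nhds s) := by
  have hsum : Summable fun k : ℕ ↦ (k.factorial : ℝ)⁻¹ * (M * R ^ k) :=
    ((Real.summable_pow_div_factorial R).mul_left M).congr fun k ↦ by ring
  have hbound : ∀ {z : ℂ} {k : ℕ}, ‖z‖ ≤ (k.factorial : ℝ)⁻¹ →
      ‖z * a k‖ ≤ (k.factorial : ℝ)⁻¹ * (M * R ^ k) := fun {z k} hz ↦ by
    rw [norm_mul]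
    exact mul_le_mul hz (ha k) (norm_nonneg _) (by positivity)
  have hs : Summable fun k : ℕ ↦ (k.factorial : ℂ)⁻¹ * a k :=
    hsum.of_norm_bounded fun k ↦ hbound (by simp)
  refine ⟨_, hs.hasSum.tendsto_sum_nat, ?_⟩
  refine (tendsto_tsum_of_dominated_convergence hsum
    (fun k ↦ (tendsto_choose_mul_inv_pow k).mul_const (a k))
    (Eventually.of_forall fun n k ↦ hbound (norm_choose_mul_inv_pow_le n k))).congr fun n ↦ ?_
  refine tsum_eq_sum fun k hk ↦ ?_
  rw [Nat.choose_eq_zero_of_lt (Nat.lt_of_succ_le (not_lt.1 (Finset.mem_range.not.1 hk)))]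
  simp

section Coalgebra

variable {C : Type*} [AddCommGroup C] [Module ℂ C] [Coalgebra ℂ C]

lemma toConv_convPow (ψ : C →ₗ[ℂ] ℂ) (k : ℕ) :
    WithConv.toConv (convPow ψ k) = WithConv.toConv ψ ^ k := by
  induction k with
  | zero => rfl
  | succ k ih =>
    rw [pow_succ, ← ih]
    ext x
    simp only [convPow, conv, LinearMap.convMul_def]
    congr 2

lemma convPow_apply (ψ : C →ₗ[ℂ] ℂ) (k : ℕ) (c : C) :
    convPow ψ k c = (WithConv.toConv ψ ^ k) c := by
  rw [← toConv_convPow]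

/-- For each `c`, some nonzero polynomial in `f` generates a left ideal of the convolution algebra
that vanishes at `c`. -/
lemma exists_polynomial_mul_aeval_apply_eq_zero (f : WithConv (C →ₗ[ℂ] ℂ)) (c : C) :
    ∃ p : ℂ[X], p ≠ 0 ∧ ∀ g : WithConv (C →ₗ[ℂ] ℂ), (g * aeval f p) c = 0 := by
  let r := Coalgebra.Repr.arbitrary ℂ c
  let L : ℂ[X] →ₗ[ℂ] (r.index → ℂ) := LinearMap.pi fun i ↦
    LinearMap.applyₗ (r.right i) ∘ₗ (WithConv.linearEquiv ℂ (C →ₗ[ℂ] ℂ)).toLinearMap ∘ₗ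
      (aeval f).toLinearMap
  have hL : ¬ Function.Injective L := fun h ↦ Polynomial.not_finite (Module.Finite.of_injective L h)
  obtain ⟨p, hp, hp0⟩ : ∃ p, L p = 0 ∧ p ≠ 0 := by
    rw [injective_iff_map_eq_zero] at hL
    push Not at hL
    exact hL
  refine ⟨p, hp0, fun g ↦ ?_⟩
  rw [r.convMul_apply]
  refine Finset.sum_eq_zero fun i hi ↦ ?_
  have h : (aeval f p) (r.right i) = 0 := congrFun hp ⟨i, hi⟩
  rw [h, mul_zero]

lemma exists_norm_convPow_apply_le (ψ : C →ₗ[ℂ] ℂ) (c : C) :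
    ∃ M R : ℝ, ∀ k, ‖convPow ψ k c‖ ≤ M * R ^ k := by
  obtain ⟨p, hp0, hp⟩ := exists_polynomial_mul_aeval_apply_eq_zero (WithConv.toConv ψ) c
  have hlead : p.leadingCoeff ≠ 0 := leadingCoeff_ne_zero.2 hp0
  refine exists_norm_le_geometric_of_recurrence (m := p.natDegree)
    (b := fun j ↦ -(p.coeff j / p.leadingCoeff)) fun k ↦ ?_
  have h := hp (WithConv.toConv ψ ^ k)
  rw [aeval_eq_sum_range, Finset.mul_sum, WithConv.ofConv_sum, LinearMap.sum_apply,
    Finset.sum_range_succ] at h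
  simp only [mul_smul_comm, ← pow_add, WithConv.ofConv_smul, LinearMap.smul_apply, smul_eq_mul,
    ← convPow_apply, coeff_natDegree] at h
  rw [← mul_right_inj' hlead, eq_neg_of_add_eq_zero_right h, Finset.mul_sum,
    ← Finset.sum_neg_distrib]
  refine Finset.sum_congr rfl fun j _ ↦ ?_
  field_simp

lemma convPow_counit_add_smul_apply (ψ : C →ₗ[ℂ] ℂ) (z : ℂ) (n : ℕ) (c : C) :
    convPow (Coalgebra.counit (R := ℂ) + z • ψ) n c =
      ∑ k ∈ Finset.range (n + 1), (n.choose k : ℂ) * z ^ k * convPow ψ k c := by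
  have h : WithConv.toConv (Coalgebra.counit (R := ℂ) + z • ψ) =
      z • WithConv.toConv ψ + 1 := by
    rw [add_comm]
    rfl
  rw [convPow_apply, h, (Commute.one_right _).add_pow, WithConv.ofConv_sum, LinearMap.sum_apply]
  refine Finset.sum_congr rfl fun k _ ↦ ?_
  rw [one_pow, mul_one, _root_.smul_pow, ← nsmul_eq_mul', ← Nat.cast_smul_eq_nsmul ℂ, convPow_apply]
  simp [mul_assoc]

end Coalgebra

/-- For every linear functional ψ on a coalgebra C and every c ∈ C, the sequence
(δ + ψ/n)^{⋆n}(c) converges, as n → ∞, to (exp_⋆ψ)(c) = Σ_{k=0}^∞ ψ^{⋆k}(c)/k!. -/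
theorem euler_formula_convolution_exponential
    {C : Type*} [AddCommGroup C] [Module ℂ C] [Coalgebra ℂ C] (ψ : C →ₗ[ℂ] ℂ)
    (c : C) :
    ∃ s : ℂ,
      Filter.Tendsto
        (fun N : ℕ => ∑ k ∈ Finset.range N, ((k.factorial : ℂ))⁻¹ * convPow ψ k c)
        Filter.atTop (nhds s) ∧
      Filter.Tendsto
        (fun n : ℕ => convPow (Coalgebra.counit (R := ℂ) + (n : ℂ)⁻¹ • ψ) n c)
        Filter.atTop (nhds s) := by
  obtain ⟨M, R, h⟩ := exists_norm_convPow_apply_le ψ c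
  simp only [convPow_counit_add_smul_apply]
  exact tendsto_sum_choose_mul_inv_pow_mul h

end
end
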